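/- arXiv:1502.00013 — 2 statements merged into one kernel-verified Lean document; each statement's English description precedes it below -/
import Mathlib

section
/- Fix t > 0, κ ∈ (−1,1) and an integer n ≥ 1. The function g(z) := ((z²−κ²)/z²) · (z−1)(1+ξ_{2t}(z))²/(4 ξ_{2t}(z)) (that is, g(z) = (z−1)/φ_{κ,t}(z)) has a removable singularity at z = 1 and extends holomorphically to a neighborhood of z = 1, and its n-th Lagrange inversion coefficient satisfies (1/n!) · (d/dz)^{n−1} [ g(z)^n ] |_{z=1} = a_n(κ,t) = (2/(4^n n)) Σ_{k=1}^{n} binom(2n, n−k) e^{−kt} [ Σ_{m=0}^{k−1} L_{k−m−1}^{(m+1)}(2kt) · 2^m · P_n^{(m)}(κ²) ]. -/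
open scoped BigOperators

/-- Pochhammer symbol `(a)_k = a(a+1)⋯(a+k-1)` over ℝ. -/
noncomputable def pochR (a : ℝ) (k : ℕ) : ℝ := ∏ i ∈ Finset.range k, (a + i)

/-- Generalized Laguerre polynomial `L_n^{(α)}(x)`. -/
noncomputable def Lag (n : ℕ) (α : ℝ) (x : ℝ) : ℝ :=
  (1 / (n.factorial : ℝ)) * ∑ j ∈ Finset.range (n + 1),
    (pochR (-(n : ℝ)) j / (j.factorial : ℝ)) * pochR (α + j + 1) (n - j) * x ^ j

/-- The polynomials `P_n^{(m)}(ε) = ((-1)^m/m!) Σ_{k=0}^n C(n,k) (-ε)^k (2k)_m`. -/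
noncomputable def Ppoly (n m : ℕ) (ε : ℝ) : ℝ :=
  ((-1 : ℝ) ^ m / (m.factorial : ℝ)) * ∑ k ∈ Finset.range (n + 1),
    (n.choose k : ℝ) * (-ε) ^ k * pochR (2 * k) m

/-- The Taylor coefficients `a_n(κ,t)`. -/
noncomputable def acoef (κ t : ℝ) (n : ℕ) : ℝ :=
  (2 / (4 ^ n * n)) * ∑ k ∈ Finset.Icc 1 n,
    ((2 * n).choose (n - k) : ℝ) * Real.exp (-(k : ℝ) * t) *
      ∑ m ∈ Finset.range k, Lag (k - m - 1) ((m : ℝ) + 1) (2 * k * t) * 2 ^ m * Ppoly n m (κ ^ 2)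

/-- `ξ_{2t}(z) = ((z-1)/(z+1)) e^{tz}`. -/
noncomputable def xiF (t : ℝ) (z : ℂ) : ℂ := ((z - 1) / (z + 1)) * Complex.exp (t * z)

/-- Taylor series at `1`. -/
noncomputable def Tay (f : ℂ → ℂ) : PowerSeries ℂ :=
  PowerSeries.mk fun k => iteratedDeriv k f 1 / (k.factorial : ℂ)

lemma Tay_congr {f g : ℂ → ℂ} (h : f =ᶠ[nhds 1] g) : Tay f = Tay g := by
  ext k
  simp only [Tay, PowerSeries.coeff_mk, h.iteratedDeriv_eq k]

lemma Tay_mul {f g : ℂ → ℂ} (hf : AnalyticAt ℂ f 1) (hg : AnalyticAt ℂ g 1) :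
    Tay (fun z => f z * g z) = Tay f * Tay g := by
  ext k
  have h : iteratedDeriv k (fun z => f z * g z) 1 = _ :=
    iteratedDeriv_mul (n := k) hf.contDiffAt hg.contDiffAt
  simp only [Tay, PowerSeries.coeff_mk, PowerSeries.coeff_mul, h,
    Finset.Nat.sum_antidiagonal_eq_sum_range_succ_mk, Nat.succ_eq_add_one, Finset.sum_div]
  refine Finset.sum_congr rfl fun i hi ↦ ?_
  rw [Nat.cast_choose _ (by grind)]
  field_simp [Nat.factorial_ne_zero]

lemma Tay_add {f g : ℂ → ℂ} (hf : AnalyticAt ℂ f 1) (hg : AnalyticAt ℂ g 1) :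
    Tay (fun z => f z + g z) = Tay f + Tay g := by
  ext k
  have h : iteratedDeriv k (fun z => f z + g z) 1 = _ :=
    iteratedDeriv_add (n := k) hf.contDiffAt hg.contDiffAt
  simp only [Tay, PowerSeries.coeff_mk, map_add, h, add_div]

lemma Tay_const (c : ℂ) : Tay (fun _ => c) = PowerSeries.C c := by
  ext k
  rw [Tay, PowerSeries.coeff_mk, PowerSeries.coeff_C, iteratedDeriv_const]
  split_ifs with h <;> simp [h]

lemma Tay_id : Tay (fun z => z) = 1 + PowerSeries.X := by
  ext k
  have h : iteratedDeriv k (fun z : ℂ => z) 1 = _ := iteratedDeriv_id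
  rw [Tay, PowerSeries.coeff_mk, h]
  rcases k with _ | _ | k <;> simp [PowerSeries.coeff_one, PowerSeries.coeff_X]

lemma Tay_pow {f : ℂ → ℂ} (hf : AnalyticAt ℂ f 1) (n : ℕ) :
    Tay (fun z => f z ^ n) = Tay f ^ n := by
  induction n with
  | zero => simp [Tay_const]
  | succ n ih =>
    simp only [pow_succ]
    rw [Tay_mul (hf.fun_pow n) hf, ih]

lemma Tay_exp (c : ℂ) : Tay (fun z => Complex.exp (c * z)) =
    PowerSeries.C (Complex.exp c) * PowerSeries.rescale c (PowerSeries.exp ℂ) := by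
  ext k
  simp [Tay, PowerSeries.coeff_rescale, PowerSeries.coeff_exp, iteratedDeriv_cexp_const_mul]
  ring

lemma pochR_nat (a k : ℕ) : pochR ((a : ℝ) + 1) k * (a.factorial : ℝ) = ((a + k).factorial : ℝ) := by
  induction k with
  | zero => simp [pochR]
  | succ k ih =>
    have : pochR ((a : ℝ) + 1) (k + 1) = pochR ((a : ℝ) + 1) k * ((a : ℝ) + 1 + k) := by
      simp [pochR, Finset.prod_range_succ]
    rw [this, ← Nat.add_assoc, Nat.factorial_succ]
    push_cast
    rw [← ih]; ring

lemma pochR_neg (N j : ℕ) (h : j ≤ N) :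
    pochR (-(N : ℝ)) j * ((N - j).factorial : ℝ) = (-1) ^ j * (N.factorial : ℝ) := by
  induction j with
  | zero => simp [pochR]
  | succ k ih =>
    have : pochR (-(N : ℝ)) (k + 1) = pochR (-(N : ℝ)) k * (-(N : ℝ) + k) := by
      simp [pochR, Finset.prod_range_succ]
    have ih := ih (by omega)
    obtain ⟨d, rfl⟩ : ∃ d, N = k + 1 + d := ⟨N - (k + 1), by omega⟩
    have e1 : k + 1 + d - (k + 1) = d := by omega
    have e2 : k + 1 + d - k = d + 1 := by omega
    rw [e2, Nat.factorial_succ] at ih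
    rw [this, e1, pow_succ]
    push_cast at ih ⊢
    linear_combination (-1) * ih

lemma Lag_eq (N m : ℕ) (x : ℝ) :
    Lag N ((m : ℝ) + 1) x = ∑ j ∈ Finset.range (N + 1),
      (-x) ^ j / (j.factorial : ℝ) * ((N + m + 1).choose (N - j) : ℝ) := by
  rw [Lag, Finset.mul_sum]
  refine Finset.sum_congr rfl fun j hj => ?_
  have hj : j ≤ N := by simpa [Nat.lt_succ_iff] using hj
  have h1 := pochR_neg N j hj
  have h2 := pochR_nat (m + 1 + j) (N - j)
  have h3 := Nat.add_choose_mul_factorial_mul_factorial (m + 1 + j) (N - j)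
  have e' : m + 1 + j + (N - j) = N + m + 1 := by omega
  rw [← h3, e'] at h2
  push_cast at h2
  have h4 : pochR ((m : ℝ) + 1 + j + 1) (N - j) =
      ((N + m + 1).choose (N - j) : ℝ) * ((N - j).factorial : ℝ) :=
    mul_right_cancel₀ (b := ((m + 1 + j).factorial : ℝ)) (by positivity) (by rw [h2]; ring)
  have h5 : ((-x) ^ j) = (-1) ^ j * x ^ j := by rw [neg_pow]
  rw [h4, h5]
  have hN : (N.factorial : ℝ) ≠ 0 := by positivity
  field_simp
  linear_combination (((N + m + 1).choose (N - j) : ℝ) * x ^ j) * h1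

open PowerSeries in
lemma coeff_two_add (k i : ℕ) :
    coeff i ((2 + X : PowerSeries ℝ) ^ k) = 2 ^ (k - i) * (k.choose i : ℝ) := by
  have : ((2 + X : PowerSeries ℝ) ^ k) =
      (((Polynomial.X + Polynomial.C 2 : Polynomial ℝ) ^ k : Polynomial ℝ) : PowerSeries ℝ) := by
    have h2 : (2 : PowerSeries ℝ) = C 2 := (map_ofNat C 2).symm
    simp [h2, add_comm]
  rw [this, Polynomial.coeff_coe, Polynomial.coeff_X_add_C_pow]

/-- Taylor series of `(z+1) e^{-tz}`. -/
noncomputable def eS (t : ℝ) : PowerSeries ℝ :=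
  PowerSeries.C (Real.exp (-t)) * (2 + PowerSeries.X) *
    PowerSeries.rescale (-t) (PowerSeries.exp ℝ)

open PowerSeries in
lemma coeff_eS (t : ℝ) (N m : ℕ) :
    coeff N (eS t ^ (N + m + 1)) = Real.exp (-((N + m + 1 : ℕ) : ℝ) * t) *
      (Lag N ((m : ℝ) + 1) (2 * ((N + m + 1 : ℕ) : ℝ) * t) * 2 ^ (m + 1)) := by
  set k := N + m + 1 with hk
  rw [eS, mul_pow, mul_pow, ← map_pow, ← map_pow (rescale (-t)), exp_pow_eq_rescale_exp, mul_assoc, coeff_C_mul,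
    ← Real.exp_nat_mul]
  congr 1
  · congr 1; ring
  rw [mul_comm, coeff_mul, Finset.Nat.sum_antidiagonal_eq_sum_range_succ_mk, Lag_eq, Finset.sum_mul]
  refine Finset.sum_congr rfl fun j hj => ?_
  have hj : j ≤ N := by simpa [Nat.lt_succ_iff] using hj
  simp only [coeff_two_add, coeff_rescale, coeff_exp]
  have e : k - (N - j) = m + 1 + j := by omega
  rw [e, ← hk, pow_add 2 (m + 1) j]
  have : (-(2 * (k : ℝ) * t)) ^ j = (-t) ^ j * 2 ^ j * k ^ j := by
    rw [← mul_pow, ← mul_pow]; congr 1; ring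
  rw [this]
  simp
  ring

/-- Taylor series of `1/z`. -/
noncomputable def uS : PowerSeries ℝ := PowerSeries.rescale (-1) (PowerSeries.mk 1)

open PowerSeries in
lemma uS_mul : (1 + X) * uS = 1 := by
  have h := congrArg (rescale (-1 : ℝ)) (mk_one_mul_one_sub_eq_one ℝ)
  rw [map_mul, map_one, map_sub, map_one, rescale_X] at h
  rw [mul_comm, uS]
  simpa using h

open PowerSeries in
lemma coeff_uS (d m : ℕ) :
    coeff m (uS ^ d) = (-1) ^ m / (m.factorial : ℝ) * pochR d m := by
  rw [uS, ← map_pow, coeff_rescale]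
  rcases d with _ | d
  · rcases m with _ | m
    · simp [pochR]
    · simp [pochR, Finset.prod_range_succ', PowerSeries.coeff_one]
  · rw [mk_one_pow_eq_mk_choose_add, coeff_mk]
    have h2 := pochR_nat d m
    have h3 := Nat.add_choose_mul_factorial_mul_factorial d m
    rw [Nat.choose_symm_add.symm] at h3
    rw [← h3] at h2
    push_cast at h2 ⊢
    have h4 : pochR ((d : ℝ) + 1) m = ((d + m).choose d : ℝ) * (m.factorial : ℝ) :=
      mul_right_cancel₀ (b := (d.factorial : ℝ)) (by positivity) (by rw [h2]; ring)
    rw [h4]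
    field_simp

/-- Taylor series of `1 - κ²/z²`. -/
noncomputable def aS (κ : ℝ) : PowerSeries ℝ := 1 + PowerSeries.C (-κ ^ 2) * uS ^ 2

open PowerSeries in
lemma coeff_aS (κ : ℝ) (n m : ℕ) : coeff m (aS κ ^ n) = Ppoly n m (κ ^ 2) := by
  rw [aS, add_comm, add_pow, map_sum, Ppoly, Finset.mul_sum]
  refine Finset.sum_congr rfl fun j hj => ?_
  have : (C (-κ ^ 2) * uS ^ 2) ^ j * 1 ^ (n - j) * (n.choose j : PowerSeries ℝ)
      = C ((-κ ^ 2) ^ j * (n.choose j : ℝ)) * uS ^ (2 * j) := by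
    simp [mul_pow, ← pow_mul]; ring
  rw [this, coeff_C_mul, coeff_uS]
  push_cast
  ring

open PowerSeries in
lemma coeff_main (κ t : ℝ) (n : ℕ) (hn : 1 ≤ n) (fS : PowerSeries ℝ) (hf : eS t * fS = 1) :
    (1 / (n : ℝ)) * coeff (n - 1) ((C (1 / 4) * aS κ * eS t * (1 + X * fS) ^ 2) ^ n)
      = acoef κ t n := by
  have key : (C (1 / 4) * aS κ * eS t * (1 + X * fS) ^ 2) ^ n
      = ∑ j ∈ Finset.range (2 * n + 1), C ((1 / 4) ^ n * ((2 * n).choose j : ℝ)) *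
          (X ^ j * (aS κ ^ n * (eS t ^ n * fS ^ j))) := by
    rw [mul_pow, ← pow_mul, add_comm (1 : PowerSeries ℝ), add_pow, Finset.mul_sum]
    refine Finset.sum_congr rfl fun j hj => ?_
    simp only [mul_pow, map_mul, map_pow, map_natCast, one_pow]
    ring
  have split : Finset.range (2 * n + 1) = Finset.range (n + (n + 1)) := by congr 1; omega
  rw [key, map_sum, split, Finset.sum_range_add]
  have z : ∑ x ∈ Finset.range (n + 1), coeff (n - 1) (C ((1 / 4) ^ n * ((2 * n).choose (n + x) : ℝ)) *
          (X ^ (n + x) * (aS κ ^ n * (eS t ^ n * fS ^ (n + x))))) = 0 := by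
    refine Finset.sum_eq_zero fun x _ => ?_
    rw [coeff_C_mul, coeff_X_pow_mul', if_neg (by omega), mul_zero]
  rw [z, add_zero, acoef, Finset.mul_sum, Finset.mul_sum]
  refine Finset.sum_bij' (fun j _ => n - j) (fun k _ => n - k) ?_ ?_ ?_ ?_ ?_
  · intro j hj; simp at hj ⊢; omega
  · intro j hj; simp at hj ⊢; omega
  · intro j hj; simp at hj ⊢; omega
  · intro j hj; simp at hj ⊢; omega
  · intro j hj
    have hj : j < n := by simpa using hj
    obtain ⟨k, rfl⟩ : ∃ k, n = j + (k + 1) := ⟨n - j - 1, by omega⟩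
    set n := j + (k + 1) with hn'
    have e1 : n - j = k + 1 := by omega
    have e2 : n - (k + 1) = j := by omega
    have e3 : n - 1 - j = k := by omega
    have e4 : eS t ^ n * fS ^ j = eS t ^ (k + 1) := by
      rw [hn', pow_add, mul_right_comm, ← mul_pow, hf, one_pow, one_mul]
    rw [coeff_C_mul, coeff_X_pow_mul', if_pos (by omega), e4, e3, e1, e2, coeff_mul,
      Finset.Nat.sum_antidiagonal_eq_sum_range_succ_mk]
    simp only [Finset.mul_sum]
    refine Finset.sum_congr rfl fun m hm => ?_
    have hm : m ≤ k := by simpa [Nat.lt_succ_iff] using hm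
    obtain ⟨N, rfl⟩ : ∃ N, k = N + m := ⟨k - m, by omega⟩
    have e5 : N + m + 1 - m - 1 = N := by omega
    have e6 : N + m - m = N := by omega
    rw [e5, e6, coeff_aS, coeff_eS]
    have : (4 : ℝ) ^ n ≠ 0 := by positivity
    simp only [one_div, inv_pow]
    field_simp
    ring

theorem stmt0 (t κ : ℝ) (ht : 0 < t) (hκ : κ ∈ Set.Ioo (-1 : ℝ) 1) (n : ℕ) (hn : 1 ≤ n) :
    ∃ g : ℂ → ℂ, AnalyticAt ℂ g 1 ∧
      (∀ᶠ z in nhdsWithin (1 : ℂ) {(1 : ℂ)}ᶜ,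
        g z = ((z ^ 2 - (κ : ℂ) ^ 2) / z ^ 2) * (z - 1) * (1 + xiF t z) ^ 2 / (4 * xiF t z)) ∧
      (1 / (n.factorial : ℂ)) * iteratedDeriv (n - 1) (fun z => (g z) ^ n) 1
        = ((acoef κ t n : ℝ) : ℂ) := by
  let φ : PowerSeries ℝ →+* PowerSeries ℂ := PowerSeries.map Complex.ofRealHom
  let u : ℂ → ℂ := fun z => z⁻¹
  let A : ℂ → ℂ := fun z => 1 + (-(κ : ℂ) ^ 2) * (u z) ^ 2
  let E : ℂ → ℂ := fun z => (z + 1) * Complex.exp (-(t : ℂ) * z)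
  let F : ℂ → ℂ := fun z => (E z)⁻¹
  let g : ℂ → ℂ := fun z => 1 / 4 * A z * E z * (1 + (z + (-1)) * F z) ^ 2
  have hid : AnalyticAt ℂ (fun z : ℂ => z) 1 := analyticAt_id
  have hc (c : ℂ) : AnalyticAt ℂ (fun _ : ℂ => c) 1 := analyticAt_const
  have hu : AnalyticAt ℂ u 1 := hid.fun_inv one_ne_zero
  have hu2 : AnalyticAt ℂ (fun z => u z ^ 2) 1 := hu.fun_pow 2
  have hA : AnalyticAt ℂ A 1 := (hc 1).fun_add ((hc _).fun_mul hu2)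
  have hz1 : AnalyticAt ℂ (fun z : ℂ => z + 1) 1 := hid.fun_add (hc 1)
  have hzm : AnalyticAt ℂ (fun z : ℂ => z + (-1)) 1 := hid.fun_add (hc (-1))
  have hex : AnalyticAt ℂ (fun z : ℂ => Complex.exp (-(t : ℂ) * z)) 1 :=
    ((hc _).fun_mul hid).cexp
  have hE : AnalyticAt ℂ E 1 := hz1.fun_mul hex
  have hE1 : E 1 ≠ 0 := by
    simp only [E]
    exact mul_ne_zero (by norm_num) (Complex.exp_ne_zero _)
  have hF : AnalyticAt ℂ F 1 := hE.fun_inv hE1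
  have hxi : AnalyticAt ℂ (fun z : ℂ => (z + (-1)) * F z) 1 := hzm.fun_mul hF
  have hb : AnalyticAt ℂ (fun z : ℂ => 1 + (z + (-1)) * F z) 1 := (hc 1).fun_add hxi
  have hg0 : AnalyticAt ℂ (fun z => 1 / 4 * A z) 1 := (hc _).fun_mul hA
  have hg1 : AnalyticAt ℂ (fun z => 1 / 4 * A z * E z) 1 := hg0.fun_mul hE
  have hg : AnalyticAt ℂ g 1 := hg1.fun_mul (hb.fun_pow 2)
  -- Taylor series
  have Tu : Tay u = φ uS := by
    have h1 : (1 + PowerSeries.X) * Tay u = 1 := by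
      rw [← Tay_id, ← Tay_mul hid hu]
      have : (fun z : ℂ => z * u z) =ᶠ[nhds 1] fun _ => 1 := by
        filter_upwards [isOpen_ne.mem_nhds (one_ne_zero : (1 : ℂ) ≠ 0)] with z hz
        exact mul_inv_cancel₀ hz
      rw [Tay_congr this, Tay_const, map_one]
    have h2 : (1 + PowerSeries.X) * φ uS = 1 := by
      have := congrArg φ uS_mul
      simpa [φ] using this
    calc Tay u = ((1 + PowerSeries.X) * φ uS) * Tay u := by rw [h2, one_mul]
      _ = φ uS * ((1 + PowerSeries.X) * Tay u) := by ring
      _ = _ := by rw [h1, mul_one]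
  have TA : Tay A = φ (aS κ) := by
    simp only [A]
    rw [Tay_add (hc 1) ((hc _).fun_mul hu2), Tay_mul (hc _) hu2, Tay_pow hu, Tay_const, Tay_const,
      Tu, aS]
    simp [φ]
  have TE : Tay E = φ (eS t) := by
    simp only [E]
    rw [Tay_mul hz1 hex, Tay_add hid (hc 1), Tay_id, Tay_const, Tay_exp, eS]
    have h1 : φ (PowerSeries.rescale (-t) (PowerSeries.exp ℝ))
        = PowerSeries.rescale (-(t : ℂ)) (PowerSeries.exp ℂ) := by
      ext k
      simp [φ, PowerSeries.coeff_rescale, PowerSeries.coeff_exp]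
    rw [map_mul, map_mul, h1]
    simp only [φ, PowerSeries.map_C, map_add, PowerSeries.map_X, map_ofNat, map_one]
    simp only [Complex.ofRealHom_eq_coe]
    push_cast
    ring
  have hunit : ∃ fS : PowerSeries ℝ, eS t * fS = 1 := by
    refine ⟨(eS t)⁻¹, PowerSeries.mul_inv_cancel _ ?_⟩
    have h1 : PowerSeries.constantCoeff (PowerSeries.rescale (-t) (PowerSeries.exp ℝ)) = 1 := by
      rw [← PowerSeries.coeff_zero_eq_constantCoeff_apply, PowerSeries.coeff_rescale]
      simp
    have h2 : PowerSeries.constantCoeff (2 : PowerSeries ℝ) = 2 := map_ofNat _ 2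
    simp [eS, h1, h2]
  obtain ⟨fS, hfS⟩ := hunit
  have TF : Tay F = φ fS := by
    have h1 : φ (eS t) * Tay F = 1 := by
      rw [← TE, ← Tay_mul hE hF]
      have : (fun z : ℂ => E z * F z) =ᶠ[nhds 1] fun _ => 1 := by
        filter_upwards [hE.continuousAt.eventually_ne hE1] with z hz
        exact mul_inv_cancel₀ hz
      rw [Tay_congr this, Tay_const, map_one]
    have h2 : φ (eS t) * φ fS = 1 := by rw [← map_mul, hfS, map_one]
    calc Tay F = (φ (eS t) * φ fS) * Tay F := by rw [h2, one_mul]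
      _ = φ fS * (φ (eS t) * Tay F) := by ring
      _ = _ := by rw [h1, mul_one]
  have Tg : Tay (fun z => g z ^ n) = φ ((PowerSeries.C (1 / 4) * aS κ * eS t *
      (1 + PowerSeries.X * fS) ^ 2) ^ n) := by
    rw [Tay_pow hg]
    simp only [g]
    rw [Tay_mul hg1 (hb.fun_pow 2), Tay_mul hg0 hE, Tay_mul (hc _) hA, Tay_pow hb,
      Tay_add (hc 1) hxi, Tay_mul hzm hF, Tay_add hid (hc _), Tay_const, Tay_const, Tay_const,
      Tay_id, TA, TE, TF]
    simp [φ]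
  refine ⟨g, hg, ?_, ?_⟩
  · have h1 : ∀ᶠ z : ℂ in nhdsWithin (1 : ℂ) {(1 : ℂ)}ᶜ, z ≠ 0 :=
      nhdsWithin_le_nhds (isOpen_ne.mem_nhds one_ne_zero)
    have h2 : ∀ᶠ z : ℂ in nhdsWithin (1 : ℂ) {(1 : ℂ)}ᶜ, z ≠ -1 :=
      nhdsWithin_le_nhds (isOpen_ne.mem_nhds (by norm_num))
    filter_upwards [h1, h2, self_mem_nhdsWithin] with z hz0 hz1 hz
    have hzm : z - 1 ≠ 0 := sub_ne_zero.mpr hz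
    have hzp : z + 1 ≠ 0 := fun h => hz1 (eq_neg_of_add_eq_zero_left h)
    have hex : Complex.exp (t * z) ≠ 0 := Complex.exp_ne_zero _
    have e1 : Complex.exp (-(t : ℂ) * z) = (Complex.exp (t * z))⁻¹ := by
      rw [neg_mul, Complex.exp_neg]
    simp only [g, A, E, F, u, xiF, e1]
    generalize Complex.exp (t * z) = w at *
    field_simp
    ring
  · have h := congrArg (PowerSeries.coeff (n - 1)) Tg
    rw [← coeff_main κ t n hn fS hfS]
    simp only [φ, PowerSeries.coeff_map, Complex.ofRealHom_eq_coe] at h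
    rw [Complex.ofReal_mul, ← h, Tay, PowerSeries.coeff_mk]
    obtain ⟨m, rfl⟩ : ∃ m, n = m + 1 := ⟨n - 1, by omega⟩
    rw [Nat.factorial_succ]
    simp only [Nat.add_sub_cancel]
    push_cast
    field_simp
end

section
/- Let t > 0 and let m ≥ 1 be an integer. For every y ∈ 𝔻 with t·K(y)² + (2−t) ≠ 0, the series Σ_{j≥m+1} L_{j−m−1}^{(m+1)}(2jt) (e^{−t} y)^j converges and 2^{m+1} Σ_{j≥m+1} L_{j−m−1}^{(m+1)}(2jt) (e^{−t} y)^j = ((K(y)² − 1)/(t·K(y)² + (2−t))) · (K(y) − 1)^m. -/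
open scoped BigOperators

lemma aux_exp_rem (j : ℕ) : ∃ S : ℂ → ℂ, Differentiable ℂ S ∧ ∀ w : ℂ,
    Complex.exp w = ∑ i ∈ Finset.range (j + 1), w ^ i / (i.factorial : ℂ) + w ^ (j + 1) * S w := by
  set f : ℂ → ℂ := fun w =>
    (Complex.exp w - ∑ i ∈ Finset.range (j + 1), w ^ i / (i.factorial : ℂ)) / w ^ (j + 1) with hf
  have hd : ∀ w : ℂ, w ≠ 0 → DifferentiableAt ℂ f w := by
    intro w hw
    have h1 : w ^ (j + 1) ≠ 0 := pow_ne_zero _ hw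
    have h2 : DifferentiableAt ℂ (fun w : ℂ => w ^ (j + 1)) w := by fun_prop
    have h3 : DifferentiableAt ℂ (fun w : ℂ => Complex.exp w -
        ∑ i ∈ Finset.range (j + 1), w ^ i / (i.factorial : ℂ)) w := by fun_prop
    exact h3.div h2 h1
  have hball : DifferentiableOn ℂ
      (Function.update f 0 (Filter.limUnder (nhdsWithin 0 {0}ᶜ) f)) (Metric.ball 0 1) := by
    apply Complex.differentiableOn_update_limUnder_of_bddAbove (Metric.ball_mem_nhds _ one_pos)
    · intro w hw
      exact (hd w hw.2).differentiableWithinAt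
    · refine ⟨(((j+1).succ : ℝ) * ((j+1).factorial * ((j+1 : ℕ) : ℝ) : ℝ)⁻¹), ?_⟩
      rintro _ ⟨w, ⟨hw, hw0⟩, rfl⟩
      have hw0' : w ≠ 0 := hw0
      have hw1 : ‖w‖ ≤ 1 := by
        have : ‖w‖ < 1 := by simpa using hw
        exact this.le
      have := Complex.exp_bound hw1 (Nat.succ_pos j)
      simp only [Function.comp, hf, norm_div, norm_pow]
      rw [div_le_iff₀ (by positivity), mul_comm]
      exact this
  refine ⟨Function.update f 0 (Filter.limUnder (nhdsWithin 0 {0}ᶜ) f), ?_, ?_⟩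
  · intro w
    by_cases hw : w = 0
    · subst hw
      exact hball.differentiableAt (Metric.ball_mem_nhds _ one_pos)
    · refine (hd w hw).congr_of_eventuallyEq ?_
      filter_upwards [isOpen_ne.mem_nhds hw] with z hz
      exact Function.update_of_ne hz _ _
  · intro w
    by_cases hw : w = 0
    · subst hw
      rw [Finset.sum_range_succ']
      simp
    · rw [Function.update_of_ne hw, hf]
      have h1 : w ^ (j + 1) ≠ 0 := pow_ne_zero _ hw
      field_simp
      ring

/-- The Laguerre polynomial as a coefficient. -/
lemma aux_coeff (j m : ℕ) (x : ℝ) :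
    ((Polynomial.X + Polynomial.C (2 : ℂ)) ^ (j + m + 1) *
      ∑ i ∈ Finset.range (j + 1), Polynomial.C ((-(x : ℂ)) ^ i / (i.factorial : ℂ)) *
        Polynomial.X ^ i).coeff j = 2 ^ (m + 1) * ((Lag j ((m : ℝ) + 1) (2 * x) : ℝ) : ℂ) := by
  rw [mul_comm, Polynomial.coeff_mul, Finset.Nat.sum_antidiagonal_eq_sum_range_succ_mk]
  rw [Lag]
  push_cast
  rw [Finset.mul_sum, Finset.mul_sum]
  refine Finset.sum_congr rfl fun i hi => ?_
  have hij : i ≤ j := Nat.lt_succ_iff.mp (Finset.mem_range.mp hi)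
  simp only [Polynomial.finsetSum_coeff, Polynomial.coeff_C_mul, Polynomial.coeff_X_pow]
  rw [Finset.sum_eq_single i (by intro b _ hb; simp [hb.symm]) (by intro h; exact absurd hi h)]
  rw [Polynomial.coeff_X_add_C_pow]
  obtain ⟨k, rfl⟩ := Nat.exists_eq_add_of_le hij
  have e1 : i + k - i = k := by omega
  have e2 : i + k + m + 1 - k = m + 1 + i := by omega
  rw [e1, e2]
  have p1 : pochR (-((i + k : ℕ) : ℝ)) i = (-1) ^ i * ((i + k).factorial / k.factorial : ℝ) := by
    have hk : (k.factorial : ℝ) ≠ 0 := by positivity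
    have : ∀ i : ℕ, pochR (-((i + k : ℕ) : ℝ)) i * k.factorial = (-1) ^ i * ((i + k).factorial : ℝ) := by
      intro i
      induction i with
      | zero => simp [pochR]
      | succ i ih =>
        have : pochR (-((i + 1 + k : ℕ) : ℝ)) (i + 1)
            = (-((i + 1 + k : ℕ) : ℝ)) * pochR (-((i + k : ℕ) : ℝ)) i := by
          unfold pochR
          rw [Finset.prod_range_succ', mul_comm]
          congr 1
          · simp
          · refine Finset.prod_congr rfl fun l _ => ?_
            push_cast
            ring
        rw [this, mul_assoc, ih, show i + 1 + k = (i + k) + 1 by ring, Nat.factorial_succ]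
        push_cast
        ring
    rw [← mul_div_assoc, ← this i, mul_div_cancel_right₀ _ hk]
  have p2 : pochR ((m : ℝ) + 1 + i + 1) k = ((i + k + m + 1).factorial / (m + 1 + i).factorial : ℝ) := by
    have hk : ((m + 1 + i).factorial : ℝ) ≠ 0 := by positivity
    rw [eq_div_iff hk]
    clear hij e1 e2 p1 hi
    induction k with
    | zero => simp [pochR]; congr 1; ring
    | succ k ih =>
      unfold pochR at ih ⊢
      rw [Finset.prod_range_succ, mul_right_comm, ih,
        show i + (k + 1) + m + 1 = (i + k + m + 1) + 1 by ring, Nat.factorial_succ (i + k + m + 1)]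
      push_cast
      ring
  have p3 : ((i + k + m + 1).choose k : ℂ) =
      ((i + k + m + 1).factorial : ℂ) / ((k.factorial : ℂ) * ((m + 1 + i).factorial : ℂ)) := by
    rw [Nat.cast_choose ℂ (by omega : k ≤ i + k + m + 1), e2]
  rw [p1, p2, p3]
  push_cast
  have h1 : (k.factorial : ℂ) ≠ 0 := by exact_mod_cast k.factorial_ne_zero
  have h2 : (i.factorial : ℂ) ≠ 0 := by exact_mod_cast i.factorial_ne_zero
  have h3 : ((i + k).factorial : ℂ) ≠ 0 := by exact_mod_cast (i + k).factorial_ne_zero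
  have h4 : ((m + 1 + i).factorial : ℂ) ≠ 0 := by exact_mod_cast (m + 1 + i).factorial_ne_zero
  rw [neg_pow (x : ℂ), mul_pow, pow_add (2 : ℂ) (m + 1) i]
  simp only [if_true]
  field_simp

/-- Residue computation. -/
lemma aux_int (w h : ℂ → ℂ) (R : ℝ) (hR0 : 0 < R) (hR1 : R < 1)
    (hw : DifferentiableOn ℂ w (Metric.ball 0 1)) (hh : DifferentiableOn ℂ h (Metric.ball 0 1))
    (hwh : ∀ z ∈ Metric.ball (0 : ℂ) 1, w z = z * h z)
    (hh0 : ∀ z ∈ Metric.ball (0 : ℂ) 1, h z ≠ 0) (j k : ℕ) :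
    (∮ z in C(0, R), (w z ^ (j + 1))⁻¹ * w z ^ k * deriv w z) =
      if k = j then 2 * Real.pi * Complex.I else 0 := by
  have hsub : Metric.sphere (0 : ℂ) R ⊆ Metric.ball 0 1 := fun z hz => by
    have : ‖z‖ = R := by simpa using hz
    simp [this, hR1]
  have hcsub : Metric.closedBall (0 : ℂ) R ⊆ Metric.ball 0 1 :=
    Metric.closedBall_subset_ball hR1
  have hz0 : ∀ z ∈ Metric.sphere (0 : ℂ) R, z ≠ 0 := fun z hz h0 => by
    have : ‖z‖ = R := by simpa using hz
    rw [h0, norm_zero] at this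
    exact hR0.ne this
  have hw0 : ∀ z ∈ Metric.sphere (0 : ℂ) R, w z ≠ 0 := fun z hz => by
    rw [hwh z (hsub hz)]
    exact mul_ne_zero (hz0 z hz) (hh0 z (hsub hz))
  have hwd : ∀ z ∈ Metric.ball (0 : ℂ) 1, HasDerivAt w (deriv w z) z := fun z hz =>
    (hw.differentiableAt (Metric.isOpen_ball.mem_nhds hz)).hasDerivAt
  have hhd : ∀ z ∈ Metric.ball (0 : ℂ) 1, HasDerivAt h (deriv h z) z := fun z hz =>
    (hh.differentiableAt (Metric.isOpen_ball.mem_nhds hz)).hasDerivAt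
  have hdh : DifferentiableOn ℂ (deriv h) (Metric.ball 0 1) := hh.deriv Metric.isOpen_ball
  split_ifs with hkj
  · subst hkj
    have hc : DifferentiableOn ℂ (fun z => (h z)⁻¹ * deriv h z) (Metric.ball 0 1) :=
      (hh.inv hh0).mul hdh
    have e : Set.EqOn (fun z => (w z ^ (k + 1))⁻¹ * w z ^ k * deriv w z)
        (fun z => (z - 0)⁻¹ + (h z)⁻¹ * deriv h z) (Metric.sphere 0 R) := by
      intro z hz
      have hzb := hsub hz
      have hd : deriv w z = h z + z * deriv h z := by
        have h1 : HasDerivAt (fun z => z * h z) (1 * h z + z * deriv h z) z :=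
          (hasDerivAt_id z).mul (hhd z hzb)
        have h2 : w =ᶠ[nhds z] fun z => z * h z := by
          filter_upwards [Metric.isOpen_ball.mem_nhds hzb] with u hu using hwh u hu
        rw [h2.deriv_eq, h1.deriv, one_mul]
      have a1 := hz0 z hz
      have a2 := hh0 z hzb
      simp only [sub_zero]
      rw [hd, hwh z hzb]
      field_simp
      ring
    rw [circleIntegral.integral_congr hR0.le e, circleIntegral.integral_add,
      circleIntegral.integral_sub_center_inv 0 hR0.ne',
      Complex.circleIntegral_eq_zero_of_differentiable_on_off_countable hR0.le
        (Set.countable_empty) (hc.continuousOn.mono hcsub), add_zero]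
    · intro z hz
      exact hc.differentiableAt (Metric.isOpen_ball.mem_nhds
        (hcsub (Metric.ball_subset_closedBall hz.1)))
    · apply ContinuousOn.circleIntegrable hR0.le
      intro z hz
      have := hz0 z hz
      exact ((continuousAt_id.sub continuousAt_const).inv₀ (by simpa using this)).continuousWithinAt
    · exact (hc.continuousOn.mono hsub).circleIntegrable hR0.le
  · have hq : ((k : ℤ) - j : ℂ) ≠ 0 := by
      have : (k : ℤ) - j ≠ 0 := by omega
      exact_mod_cast this
    apply circleIntegral.integral_eq_zero_of_hasDerivWithinAt
      (f := fun z => ((k : ℤ) - j : ℂ)⁻¹ * w z ^ ((k : ℤ) - j)) hR0.le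
    intro z hz
    have a := hw0 z hz
    have h1 := ((hasDerivAt_zpow ((k : ℤ) - j) (w z) (Or.inl a)).comp z
      (hwd z (hsub hz))).const_mul ((k : ℤ) - j : ℂ)⁻¹
    refine (h1.congr_deriv ?_).hasDerivWithinAt
    have e : w z ^ ((k : ℤ) - j - 1) = (w z ^ (j + 1))⁻¹ * w z ^ k := by
      rw [sub_sub, zpow_sub₀ a, zpow_natCast, div_eq_mul_inv, mul_comm]
      congr 2
    rw [e]
    push_cast at hq ⊢
    field_simp

theorem stmt6 (t : ℝ) (ht : 0 < t) (m : ℕ) (hm : 1 ≤ m)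
    (K : ℂ → ℂ) (hK : DifferentiableOn ℂ K (Metric.ball 0 1)) (hK0 : K 0 = 1)
    (hKre : ∀ z ∈ Metric.ball (0 : ℂ) 1, 0 < (K z).re)
    (hKxi : ∀ z ∈ Metric.ball (0 : ℂ) 1,
      ((K z - 1) / (K z + 1)) * Complex.exp (t * K z) = z)
    (y : ℂ) (hy : y ∈ Metric.ball (0 : ℂ) 1)
    (hden : (t : ℂ) * (K y) ^ 2 + (2 - t) ≠ 0) :
    HasSum (fun j : ℕ => ((Lag j ((m : ℝ) + 1) (2 * ((j : ℝ) + m + 1) * t) : ℝ) : ℂ) *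
        (Complex.exp (-(t : ℂ)) * y) ^ (j + m + 1))
      (((((K y) ^ 2 - 1) / ((t : ℂ) * (K y) ^ 2 + (2 - t))) * (K y - 1) ^ m) / 2 ^ (m + 1)) := by
  have hOpen : IsOpen (Metric.ball (0 : ℂ) 1) := Metric.isOpen_ball
  set w : ℂ → ℂ := fun z => K z - 1 with hwdef
  set h : ℂ → ℂ := fun z => (w z + 2) * Complex.exp (-(t : ℂ)) * Complex.exp (-(t : ℂ) * w z) with hhdef
  have hw : DifferentiableOn ℂ w (Metric.ball 0 1) := hK.sub_const 1
  have hh : DifferentiableOn ℂ h (Metric.ball 0 1) :=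
    ((hw.add_const 2).mul_const _).mul ((hw.const_mul _).cexp)
  have hK1 : ∀ z ∈ Metric.ball (0 : ℂ) 1, K z + 1 ≠ 0 := by
    intro z hz h0
    have h1 := hKre z hz
    have h2 := congrArg Complex.re h0
    simp at h2
    linarith
  have hh0 : ∀ z ∈ Metric.ball (0 : ℂ) 1, h z ≠ 0 := by
    intro z hz
    have h1 := hK1 z hz
    have : w z + 2 = K z + 1 := by simp only [hwdef]; ring
    simp only [hhdef, this]
    exact mul_ne_zero (mul_ne_zero h1 (Complex.exp_ne_zero _)) (Complex.exp_ne_zero _)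
  have hexp : ∀ z, Complex.exp (t * K z) * (Complex.exp (-(t : ℂ)) * Complex.exp (-(t : ℂ) * w z)) = 1 := by
    intro z
    rw [← Complex.exp_add, ← Complex.exp_add, ← Complex.exp_zero]
    congr 1
    simp only [hwdef]; ring
  have hwh : ∀ z ∈ Metric.ball (0 : ℂ) 1, w z = z * h z := by
    intro z hz
    have h1 := hK1 z hz
    have e := hexp z
    have h2 : w z + 2 = K z + 1 := by simp only [hwdef]; ring
    have h3 : h z = (K z + 1) * (Complex.exp (-(t : ℂ)) * Complex.exp (-(t : ℂ) * w z)) := by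
      simp only [hhdef, h2]; ring
    calc w z = (K z - 1) * (Complex.exp (t * K z) *
          (Complex.exp (-(t : ℂ)) * Complex.exp (-(t : ℂ) * w z))) := by rw [e, mul_one]
      _ = (((K z - 1) / (K z + 1)) * Complex.exp (t * K z)) * ((K z + 1) *
          (Complex.exp (-(t : ℂ)) * Complex.exp (-(t : ℂ) * w z))) := by field_simp
      _ = z * h z := by rw [hKxi z hz, h3]
  have hdw : DifferentiableOn ℂ (deriv w) (Metric.ball 0 1) := hw.deriv hOpen
  have hval : y * deriv w y = (K y ^ 2 - 1) / ((t : ℂ) * K y ^ 2 + (2 - t)) := by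
    have hwd : HasDerivAt w (deriv w y) y :=
      (hw.differentiableAt (hOpen.mem_nhds hy)).hasDerivAt
    have hhd : HasDerivAt h ((deriv w y) * Complex.exp (-(t : ℂ)) * Complex.exp (-(t : ℂ) * w y) +
        (w y + 2) * Complex.exp (-(t : ℂ)) * (Complex.exp (-(t : ℂ) * w y) * (-(t : ℂ) * deriv w y))) y :=
      ((hwd.add_const 2).mul_const _).mul ((hwd.const_mul _).cexp)
    have h1 := (hasDerivAt_id y).mul hhd
    have h2 : w =ᶠ[nhds y] fun z => z * h z := by
      filter_upwards [hOpen.mem_nhds hy] with u hu using hwh u hu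
    have h3 := hwd.unique (h1.congr_of_eventuallyEq h2)
    have h4 := hwh y hy
    have h5 := hK1 y hy
    simp only [id] at h3
    rw [eq_div_iff hden]
    have hKw : K y = w y + 1 := by simp only [hwdef]; ring
    rw [hKw] at h5 ⊢
    simp only [hhdef] at h3 h4
    generalize w y = W at *
    generalize deriv w y = D at *
    generalize Complex.exp (-(t : ℂ)) * Complex.exp (-(t : ℂ) * W) = E at *
    generalize Complex.exp (-(t : ℂ)) = E1 at *
    generalize Complex.exp (-(t : ℂ) * W) = E2 at *
    have h6 : W + 2 ≠ 0 := by convert h5 using 1; ring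
    apply mul_left_cancel₀ h6
    linear_combination (y * (W + 2) ^ 2) * h3 + (-(y * (W+2)*D) + y*t*(W+2)^2*D  - (W+2)^2) * h4
  obtain ⟨R, hyR, hR1⟩ := exists_between (show ‖y‖ < 1 by simpa using hy)
  have hR0 : 0 < R := (norm_nonneg y).trans_lt hyR
  lift R to NNReal using hR0.le
  have hcsub : Metric.closedBall (0 : ℂ) R ⊆ Metric.ball 0 1 := Metric.closedBall_subset_ball hR1
  have hsub : Metric.sphere (0 : ℂ) R ⊆ Metric.ball 0 1 :=
    Metric.sphere_subset_closedBall.trans hcsub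
  have hz0 : ∀ z ∈ Metric.sphere (0 : ℂ) R, z ≠ 0 := fun z hz h0 => by
    have : ‖z‖ = R := by simpa using hz
    rw [h0, norm_zero] at this
    exact hR0.ne this
  set q : ℂ → ℂ := fun z => deriv w z * h z ^ m with hqdef
  have hq : DifferentiableOn ℂ q (Metric.ball 0 1) := hdw.mul (hh.pow m)
  have hps := (hq.mono hcsub).hasFPowerSeriesOnBall (by exact_mod_cast hR0)
  have hsum := hps.hasSum (y := y) (by simpa [Metric.eball, edist_eq_enorm_sub] using (by exact_mod_cast hyR : ‖y‖₊ < R))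
  have hsum2 := hsum.mul_left (y ^ (m + 1))
  have hF : y ^ (m + 1) * q (0 + y) =
      ((K y ^ 2 - 1) / ((t : ℂ) * K y ^ 2 + (2 - t)) * (K y - 1) ^ m) := by
    rw [zero_add, ← hval, show K y - 1 = w y from rfl, hwh y hy]
    simp only [hqdef]
    ring
  rw [hF] at hsum2
  have hsum3 := hsum2.div_const (2 ^ (m + 1))
  have key : ∀ j : ℕ, ((Lag j ((m : ℝ) + 1) (2 * ((j : ℝ) + m + 1) * t) : ℝ) : ℂ) *
        (Complex.exp (-(t : ℂ)) * y) ^ (j + m + 1) =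
      y ^ (m + 1) * (cauchyPowerSeries q 0 R j fun _ => y) / 2 ^ (m + 1) := by
    intro j
    set x : ℝ := ((j : ℝ) + m + 1) * t with hx
    have hxL : 2 * ((j : ℝ) + m + 1) * t = 2 * x := by rw [hx]; ring
    set P : Polynomial ℂ := (Polynomial.X + Polynomial.C (2 : ℂ)) ^ (j + m + 1) *
      ∑ i ∈ Finset.range (j + 1), Polynomial.C ((-(x : ℂ)) ^ i / (i.factorial : ℂ)) *
        Polynomial.X ^ i with hP
    have hcoef : P.coeff j = 2 ^ (m + 1) * ((Lag j ((m : ℝ) + 1) (2 * x) : ℝ) : ℂ) :=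
      aux_coeff j m x
    obtain ⟨S, hSd, hS⟩ := aux_exp_rem j
    set G : ℂ → ℂ := fun z => (w z + 2) ^ (j + m + 1) * (-(x : ℂ)) ^ (j + 1) *
      S (-(x : ℂ) * w z) * deriv w z with hG
    have hGd : DifferentiableOn ℂ G (Metric.ball 0 1) :=
      ((((hw.add_const 2).pow _).mul_const _).mul
        (hSd.comp_differentiableOn (hw.const_mul _))).mul hdw
    have hw0 : ∀ z ∈ Metric.sphere (0 : ℂ) R, w z ≠ 0 := fun z hz => by
      rw [hwh z (hsub hz)]
      exact mul_ne_zero (hz0 z hz) (hh0 z (hsub hz))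
    have hPev : ∀ z, (w z + 2) ^ (j + m + 1) * Complex.exp (-(x : ℂ) * w z) =
        ∑ k ∈ Finset.range (P.natDegree + 1), P.coeff k * w z ^ k +
        (w z + 2) ^ (j + m + 1) * ((-(x : ℂ) * w z) ^ (j + 1) * S (-(x : ℂ) * w z)) := by
      intro z
      rw [← Polynomial.eval_eq_sum_range, hS (-(x : ℂ) * w z), hP]
      simp only [Polynomial.eval_mul, Polynomial.eval_pow, Polynomial.eval_add, Polynomial.eval_X,
        Polynomial.eval_C, Polynomial.eval_finsetSum]
      rw [mul_add]
      congr 2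
      refine Finset.sum_congr rfl fun i _ => ?_
      rw [mul_pow]; ring
    have e : Set.EqOn (fun z => (y / (z - 0)) ^ j • (z - 0)⁻¹ • q z)
        (fun z => (y ^ j * Complex.exp (-(t : ℂ)) ^ (j + m + 1)) *
          (∑ k ∈ Finset.range (P.natDegree + 1),
            P.coeff k * ((w z ^ (j + 1))⁻¹ * w z ^ k * deriv w z) + G z))
        (Metric.sphere 0 R) := by
      intro z hz
      have a0 := hz0 z hz
      have a1 := hw0 z hz
      have a2 := hh0 z (hsub hz)
      have a3 := hwh z (hsub hz)
      have b1 : (y / (z - 0)) ^ j • (z - 0)⁻¹ • q z =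
          y ^ j * ((w z ^ (j + 1))⁻¹ * h z ^ (j + m + 1) * deriv w z) := by
        simp only [hqdef, smul_eq_mul, sub_zero]
        rw [a3, div_pow, mul_pow z]
        field_simp
        ring
      have b2 : h z ^ (j + m + 1) = Complex.exp (-(t : ℂ)) ^ (j + m + 1) *
          ((w z + 2) ^ (j + m + 1) * Complex.exp (-(x : ℂ) * w z)) := by
        simp only [hhdef]
        rw [mul_pow, mul_pow, ← Complex.exp_nat_mul (-(t : ℂ) * w z),
          show ((j + m + 1 : ℕ) : ℂ) * (-(t : ℂ) * w z) = -(x : ℂ) * w z by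
            rw [hx]; push_cast; ring]
        ring
      have b3 : ∑ k ∈ Finset.range (P.natDegree + 1),
            P.coeff k * ((w z ^ (j + 1))⁻¹ * w z ^ k * deriv w z) =
          (w z ^ (j + 1))⁻¹ * (∑ k ∈ Finset.range (P.natDegree + 1), P.coeff k * w z ^ k) *
            deriv w z := by
        rw [Finset.mul_sum, Finset.sum_mul]
        exact Finset.sum_congr rfl fun _ _ => by ring
      beta_reduce
      rw [b1, b2, hPev z, b3]
      simp only [hG]
      rw [mul_pow (-(x : ℂ))]
      have a4 : w z ^ (j + 1) ≠ 0 := pow_ne_zero _ a1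
      field_simp
    have hci : ∀ k, CircleIntegrable (fun z => P.coeff k *
        ((w z ^ (j + 1))⁻¹ * w z ^ k * deriv w z)) 0 R := by
      intro k
      apply ContinuousOn.circleIntegrable hR0.le
      have c1 := hw.continuousOn.mono hsub
      have c2 := hdw.continuousOn.mono hsub
      exact continuousOn_const.mul ((((c1.pow _).inv₀
        (fun z hz => pow_ne_zero _ (hw0 z hz))).mul (c1.pow _)).mul c2)
    have hGi : CircleIntegrable G 0 R :=
      (hGd.continuousOn.mono hsub).circleIntegrable hR0.le
    have hG0 : (∮ z in C(0, R), G z) = 0 :=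
      Complex.circleIntegral_eq_zero_of_differentiable_on_off_countable hR0.le
        Set.countable_empty (hGd.continuousOn.mono hcsub) (fun z hz =>
          hGd.differentiableAt (hOpen.mem_nhds (hcsub (Metric.ball_subset_closedBall hz.1))))
    have hsumI : CircleIntegrable (fun z => ∑ k ∈ Finset.range (P.natDegree + 1),
            P.coeff k * ((w z ^ (j + 1))⁻¹ * w z ^ k * deriv w z)) 0 R := by
      have := CircleIntegrable.sum (Finset.range (P.natDegree + 1)) (fun k _ => hci k)
      convert this using 1
      ext z
      simp
    rw [cauchyPowerSeries_apply, circleIntegral.integral_congr hR0.le e,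
      circleIntegral.integral_const_mul, circleIntegral.integral_add hsumI hGi, hG0, add_zero,
      circleIntegral.integral_fun_sum (fun k _ => hci k)]
    simp_rw [circleIntegral.integral_const_mul,
      aux_int w h R hR0 hR1 hw hh hwh hh0 j]
    have hfin : ∑ k ∈ Finset.range (P.natDegree + 1),
        P.coeff k * (if k = j then 2 * (Real.pi : ℂ) * Complex.I else 0) =
        P.coeff j * (2 * Real.pi * Complex.I) := by
      simp only [mul_ite, mul_zero, Finset.sum_ite_eq', Finset.mem_range]
      split_ifs with hj
      · rfl
      · rw [Polynomial.coeff_eq_zero_of_natDegree_lt (by omega), zero_mul]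
    rw [hfin, hcoef, hxL, smul_eq_mul]
    have hpi : (2 * (Real.pi : ℂ) * Complex.I) ≠ 0 := Complex.two_pi_I_ne_zero
    generalize (2 * (Real.pi : ℂ) * Complex.I) = c at hpi ⊢
    rw [mul_pow]
    field_simp
    ring
  simpa only [key] using hsum3
end
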